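/- Let p > 0 and 0 < k₁ < k₂, and let (λ_j)_{j≥1} be a sequence with k₁ j^{-p} ≤ λ_j ≤ k₂ j^{-p} for all j ≥ 1. Then there exist constants c, C > 0 such that for all α ∈ (0,1]: (i) sup_{j≥1} λ_j²/(λ_j² + α)² ≥ c/α·(a lower bound of order α^{-1}); (ii) ∑_{j≥1} λ_j²/(λ_j² + α)² ≤ C α^{-1-1/(2p)}; and consequently ∑_{j≥1} λ_j²/(λ_j²+α)² ≤ C' α^{-1/(2p)} · sup_{j≥1} λ_j²/(λ_j²+α)², i.e. the trace-to-spectral-radius ratio of the Tikhonov regularizer is O(α^{-1/(2p)}). -/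

import Mathlib

open scoped BigOperators

theorem tikhonov_term_le_inv {x α : ℝ} (hα : 0 < α) :
    x ^ 2 / (x ^ 2 + α) ^ 2 ≤ 1 / α := by
  rw [div_le_div_iff₀ (by positivity) hα]
  nlinarith [sq_nonneg x, sq_nonneg (x ^ 2), mul_nonneg (sq_nonneg x) hα.le]

theorem tikhonov_term_le_div_sq {x α : ℝ} (hα : 0 < α) :
    x ^ 2 / (x ^ 2 + α) ^ 2 ≤ x ^ 2 / α ^ 2 := by
  gcongr
  nlinarith [sq_nonneg x]

/-- A summable real sequence which on the `q`-th block of length `M` is bounded by `g q` has sum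
at most `M * ∑ g`. -/
theorem tsum_le_mul_tsum_of_le_div {f g : ℕ → ℝ} (M : ℕ) [NeZero M] (hf : Summable f)
    (hg : Summable g) (h : ∀ j, f j ≤ g (j / M)) : ∑' j, f j ≤ M * ∑' q, g q := by
  have hs : Summable fun x : ℕ × Fin M => f ((Nat.divModEquiv M).symm x) :=
    (Equiv.summable_iff (Nat.divModEquiv M).symm).2 hf
  rw [← (Nat.divModEquiv M).symm.tsum_eq, hs.tsum_prod, ← tsum_mul_left]
  refine hs.prod.tsum_le_tsum (fun q => ?_) (hg.mul_left _)
  rw [tsum_fintype]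
  refine (Finset.sum_le_card_nsmul _ _ (g q) fun r _ => ?_).trans (by simp)
  refine (h _).trans_eq (congrArg g ?_)
  exact congrArg Prod.fst ((Nat.divModEquiv M).apply_symm_apply (q, r))

theorem summable_nat_add_one_rpow_neg_iff {s : ℝ} :
    (Summable fun j : ℕ => ((j : ℝ) + 1) ^ (-s)) ↔ 1 < s := by
  have := (summable_nat_add_iff (f := fun j : ℕ => (j : ℝ) ^ (-s)) 1)
  simp only [Nat.cast_add, Nat.cast_one] at this
  rw [this, Real.summable_nat_rpow]
  constructor <;> intro h <;> linarith

theorem rpow_neg_sq {x : ℝ} (hx : 0 ≤ x) (p : ℝ) : (x ^ (-p)) ^ 2 = x ^ (-(2 * p)) := by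
  rw [← Real.rpow_mul_natCast hx]
  congr 1
  push_cast
  ring

theorem rpow_neg_inv_rpow_neg {α p : ℝ} (hα : 0 < α) (hp : 0 < p) :
    (α ^ (-1 / (2 * p))) ^ (-(2 * p)) = α := by
  rw [← Real.rpow_mul hα.le, show -1 / (2 * p) * -(2 * p) = 1 by field_simp, Real.rpow_one]

section PolynomialDecay

variable {p k₁ k₂ : ℝ} {lam : ℕ → ℝ}

theorem tikhonov_bddAbove (lam : ℕ → ℝ) {α : ℝ} (hα : 0 < α) :
    BddAbove (Set.range fun j : ℕ => lam j ^ 2 / (lam j ^ 2 + α) ^ 2) :=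
  ⟨1 / α, by rintro _ ⟨j, rfl⟩; exact tikhonov_term_le_inv hα⟩

theorem sq_bounds_of_decay (hk₁ : 0 < k₁)
    (hlam : ∀ j : ℕ, k₁ * ((j : ℝ) + 1) ^ (-p) ≤ lam j ∧ lam j ≤ k₂ * ((j : ℝ) + 1) ^ (-p))
    (j : ℕ) : k₁ ^ 2 * ((j : ℝ) + 1) ^ (-(2 * p)) ≤ lam j ^ 2 ∧
      lam j ^ 2 ≤ k₂ ^ 2 * ((j : ℝ) + 1) ^ (-(2 * p)) := by
  obtain ⟨h₁, h₂⟩ := hlam j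
  have hj : (0 : ℝ) < ((j : ℝ) + 1) ^ (-p) := by positivity
  have h₀ : 0 < k₁ * ((j : ℝ) + 1) ^ (-p) := by positivity
  rw [← rpow_neg_sq (by positivity), ← mul_pow, ← mul_pow]
  exact ⟨pow_le_pow_left₀ h₀.le h₁ 2, pow_le_pow_left₀ (h₀.le.trans h₁) h₂ 2⟩

theorem one_le_rpow_neg_inv {α : ℝ} (hp : 0 < p) (hα : 0 < α) (hα1 : α ≤ 1) :
    1 ≤ α ^ (-1 / (2 * p)) :=
  Real.one_le_rpow_of_pos_of_le_one_of_nonpos hα hα1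
    (div_nonpos_of_nonpos_of_nonneg (by norm_num) (by positivity))

theorem tikhonov_le_iSup (hp : 0 < p) (hk₁ : 0 < k₁)
    (hlam : ∀ j : ℕ, k₁ * ((j : ℝ) + 1) ^ (-p) ≤ lam j ∧ lam j ≤ k₂ * ((j : ℝ) + 1) ^ (-p))
    {α : ℝ} (hα : 0 < α) (hα1 : α ≤ 1) :
    k₁ ^ 2 / (k₂ ^ 2 * 2 ^ (2 * p) + 1) ^ 2 / α ≤
      ⨆ j : ℕ, lam j ^ 2 / (lam j ^ 2 + α) ^ 2 := by
  set N := α ^ (-1 / (2 * p)) with hN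
  have hN1 : 1 ≤ N := one_le_rpow_neg_inv hp hα hα1
  have hNα : N ^ (-(2 * p)) = α := rpow_neg_inv_rpow_neg hα hp
  have hfloor : 1 ≤ ⌊N⌋₊ := Nat.one_le_floor_iff _ |>.2 hN1
  obtain ⟨j, hj⟩ : ∃ j, ⌊N⌋₊ = j + 1 := ⟨⌊N⌋₊ - 1, by omega⟩
  have hj₁ : (j : ℝ) + 1 ≤ N := by
    have := Nat.floor_le (zero_le_one.trans hN1)
    rw [hj] at this
    exact_mod_cast this
  have hj₂ : N / 2 ≤ (j : ℝ) + 1 := by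
    have := Nat.lt_floor_add_one N
    rw [hj] at this
    push_cast at this
    have : (0 : ℝ) ≤ j := j.cast_nonneg
    linarith
  obtain ⟨h₁, h₂⟩ := sq_bounds_of_decay hk₁ hlam j
  have hlow : k₁ ^ 2 * α ≤ lam j ^ 2 := by
    refine le_trans ?_ h₁
    gcongr
    rw [← hNα]
    exact Real.rpow_le_rpow_of_nonpos (by positivity) hj₁ (by linarith)
  have hup : lam j ^ 2 ≤ k₂ ^ 2 * 2 ^ (2 * p) * α := by
    refine h₂.trans ?_
    rw [mul_assoc]
    gcongr
    calc ((j : ℝ) + 1) ^ (-(2 * p)) ≤ (N / 2) ^ (-(2 * p)) :=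
          Real.rpow_le_rpow_of_nonpos (by positivity) hj₂ (by linarith)
      _ = 2 ^ (2 * p) * α := by
          rw [Real.div_rpow (by positivity) (by norm_num), hNα, Real.rpow_neg (by norm_num)]
          field_simp
  refine le_trans ?_ (le_ciSup (tikhonov_bddAbove lam hα) j)
  calc k₁ ^ 2 / (k₂ ^ 2 * 2 ^ (2 * p) + 1) ^ 2 / α
      = k₁ ^ 2 * α / (k₂ ^ 2 * 2 ^ (2 * p) * α + α) ^ 2 := by field_simp
    _ ≤ lam j ^ 2 / (lam j ^ 2 + α) ^ 2 := by gcongr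

theorem one_lt_of_summable_tikhonov (hp : 0 < p) (hk₁ : 0 < k₁)
    (hlam : ∀ j : ℕ, k₁ * ((j : ℝ) + 1) ^ (-p) ≤ lam j ∧ lam j ≤ k₂ * ((j : ℝ) + 1) ^ (-p))
    {α : ℝ} (hα : 0 < α) (hs : Summable fun j : ℕ => lam j ^ 2 / (lam j ^ 2 + α) ^ 2) :
    1 < 2 * p := by
  rw [← summable_nat_add_one_rpow_neg_iff]
  have hpos : 0 < k₁ ^ 2 / (k₂ ^ 2 + α) ^ 2 := by positivity
  refine (summable_mul_left_iff hpos.ne').1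
    (hs.of_nonneg_of_le (fun j => by positivity) fun j => ?_)
  obtain ⟨h₁, h₂⟩ := sq_bounds_of_decay hk₁ hlam j
  have hj : ((j : ℝ) + 1) ^ (-(2 * p)) ≤ 1 :=
    Real.rpow_le_one_of_one_le_of_nonpos (by simp) (by linarith)
  have h₃ : lam j ^ 2 ≤ k₂ ^ 2 := h₂.trans (mul_le_of_le_one_right (sq_nonneg _) hj)
  rw [div_mul_eq_mul_div]
  gcongr

theorem tikhonov_tsum_le (hp : 0 < p) (hk₁ : 0 < k₁)
    (hlam : ∀ j : ℕ, k₁ * ((j : ℝ) + 1) ^ (-p) ≤ lam j ∧ lam j ≤ k₂ * ((j : ℝ) + 1) ^ (-p))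
    {α : ℝ} (hα : 0 < α) (hα1 : α ≤ 1)
    (hs : Summable fun j : ℕ => lam j ^ 2 / (lam j ^ 2 + α) ^ 2) :
    ∑' j : ℕ, lam j ^ 2 / (lam j ^ 2 + α) ^ 2 ≤
      2 * (1 + k₂ ^ 2) * 2 ^ (2 * p) * (∑' q : ℕ, ((q : ℝ) + 1) ^ (-(2 * p))) *
        α ^ (-1 - 1 / (2 * p)) := by
  have hsum := summable_nat_add_one_rpow_neg_iff.2 (one_lt_of_summable_tikhonov hp hk₁ hlam hα hs)
  set N := α ^ (-1 / (2 * p)) with hN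
  have hN1 : 1 ≤ N := one_le_rpow_neg_inv hp hα hα1
  have hNα : N ^ (-(2 * p)) = α := rpow_neg_inv_rpow_neg hα hp
  have hNM : N ≤ ⌈N⌉₊ := Nat.le_ceil N
  have hM2 : (⌈N⌉₊ : ℝ) ≤ 2 * N := by
    have := Nat.ceil_lt_add_one (zero_le_one.trans hN1)
    linarith
  have : NeZero ⌈N⌉₊ := ⟨(Nat.ceil_pos.2 (by linarith)).ne'⟩
  have hterm (j : ℕ) : lam j ^ 2 / (lam j ^ 2 + α) ^ 2 ≤
      (1 + k₂ ^ 2) * 2 ^ (2 * p) / α * (((j / ⌈N⌉₊ : ℕ) : ℝ) + 1) ^ (-(2 * p)) := by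
    set q := j / ⌈N⌉₊
    have hq : (q : ℝ) * N ≤ (j : ℝ) + 1 := by
      have h : (q : ℝ) * ⌈N⌉₊ ≤ j := by exact_mod_cast Nat.div_mul_le_self j _
      have : (q : ℝ) * N ≤ q * ⌈N⌉₊ := by gcongr
      linarith
    have hscale : (((q : ℝ) + 1) / 2) ^ (-(2 * p)) =
        2 ^ (2 * p) * ((q : ℝ) + 1) ^ (-(2 * p)) := by
      rw [Real.div_rpow (by positivity) (by norm_num), Real.rpow_neg two_pos.le (2 * p)]
      field_simp
    have hgoal : (1 + k₂ ^ 2) * 2 ^ (2 * p) / α * ((q : ℝ) + 1) ^ (-(2 * p)) =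
        (1 + k₂ ^ 2) / α * (((q : ℝ) + 1) / 2) ^ (-(2 * p)) := by
      rw [hscale]
      ring
    rw [hgoal]
    rcases Nat.eq_zero_or_pos q with h0 | h1
    · have h : (1 : ℝ) ≤ (((q : ℝ) + 1) / 2) ^ (-(2 * p)) :=
        Real.one_le_rpow_of_pos_of_le_one_of_nonpos (by positivity) (by rw [h0]; norm_num)
          (by linarith)
      calc _ ≤ 1 / α := tikhonov_term_le_inv hα
        _ ≤ (1 + k₂ ^ 2) / α * 1 := by
            rw [mul_one]
            gcongr
            nlinarith [sq_nonneg k₂]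
        _ ≤ _ := by gcongr
    · have hq1 : (1 : ℝ) ≤ q := by exact_mod_cast h1
      have hj : ((q : ℝ) + 1) / 2 * N ≤ (j : ℝ) + 1 := by nlinarith
      have hpow : ((j : ℝ) + 1) ^ (-(2 * p)) ≤ (((q : ℝ) + 1) / 2) ^ (-(2 * p)) * α := by
        rw [← hNα, ← Real.mul_rpow (by positivity) (by positivity)]
        exact Real.rpow_le_rpow_of_nonpos (by positivity) hj (by linarith)
      calc _ ≤ lam j ^ 2 / α ^ 2 := tikhonov_term_le_div_sq hα
        _ ≤ (1 + k₂ ^ 2) * ((((q : ℝ) + 1) / 2) ^ (-(2 * p)) * α) / α ^ 2 := by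
            gcongr
            refine (sq_bounds_of_decay hk₁ hlam j).2.trans ?_
            gcongr
            linarith
        _ = _ := by field_simp
  have hαN : α ^ (-1 - 1 / (2 * p)) = N / α := by
    rw [hN, ← Real.rpow_sub_one hα.ne']
    congr 1
    ring
  have hT : 0 ≤ ∑' q : ℕ, ((q : ℝ) + 1) ^ (-(2 * p)) := tsum_nonneg fun q => by positivity
  calc _ ≤ (⌈N⌉₊ : ℝ) * ∑' q : ℕ,
        (1 + k₂ ^ 2) * 2 ^ (2 * p) / α * ((q : ℝ) + 1) ^ (-(2 * p)) :=
        tsum_le_mul_tsum_of_le_div ⌈N⌉₊ hs (hsum.mul_left _) hterm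
    _ ≤ 2 * N * ∑' q : ℕ,
        (1 + k₂ ^ 2) * 2 ^ (2 * p) / α * ((q : ℝ) + 1) ^ (-(2 * p)) := by
        rw [tsum_mul_left]
        gcongr
    _ = _ := by
        rw [tsum_mul_left, hαN]
        ring

end PolynomialDecay

/-- Let `p > 0`, `0 < k₁ < k₂`, and `(λⱼ)_{j≥1}` a sequence with
`k₁ j^{-p} ≤ λⱼ ≤ k₂ j^{-p}` (here indexed by `j+1`, `j : ℕ`).  Then there exist constants
`c, C, C' > 0` such that for all `α ∈ (0,1]`:
(i) `sup_j λⱼ²/(λⱼ²+α)² ≥ c/α`;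
(ii) `∑_j λⱼ²/(λⱼ²+α)² ≤ C α^{-1-1/(2p)}`;
(iii) consequently `∑_j λⱼ²/(λⱼ²+α)² ≤ C' α^{-1/(2p)} · sup_j λⱼ²/(λⱼ²+α)²`, i.e. the
trace-to-spectral-radius ratio of the Tikhonov regularizer is `O(α^{-1/(2p)})`. -/
theorem tikhonov_trace_over_spectralRadius
    (p k₁ k₂ : ℝ) (hp : 0 < p) (hk₁ : 0 < k₁) (hk : k₁ < k₂)
    (lam : ℕ → ℝ)
    (hlam : ∀ j : ℕ, k₁ * ((j : ℝ) + 1) ^ (-p) ≤ lam j ∧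
                     lam j ≤ k₂ * ((j : ℝ) + 1) ^ (-p)) :
    ∃ c C C' : ℝ, 0 < c ∧ 0 < C ∧ 0 < C' ∧
      ∀ α : ℝ, 0 < α → α ≤ 1 →
        (c / α ≤ ⨆ j : ℕ, lam j ^ 2 / (lam j ^ 2 + α) ^ 2) ∧
        ((∑' j : ℕ, lam j ^ 2 / (lam j ^ 2 + α) ^ 2)
            ≤ C * α ^ (-1 - 1 / (2 * p))) ∧
        ((∑' j : ℕ, lam j ^ 2 / (lam j ^ 2 + α) ^ 2)
            ≤ C' * α ^ (-(1 : ℝ) / (2 * p)) *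
                ⨆ j : ℕ, lam j ^ 2 / (lam j ^ 2 + α) ^ 2) := by
  have hc : 0 < k₁ ^ 2 / (k₂ ^ 2 * 2 ^ (2 * p) + 1) ^ 2 := by positivity
  set c := k₁ ^ 2 / (k₂ ^ 2 * 2 ^ (2 * p) + 1) ^ 2
  have hT : 0 ≤ ∑' q : ℕ, ((q : ℝ) + 1) ^ (-(2 * p)) := tsum_nonneg fun q => by positivity
  set C := 2 * (1 + k₂ ^ 2) * 2 ^ (2 * p) * (∑' q : ℕ, ((q : ℝ) + 1) ^ (-(2 * p))) with hC
  have hC0 : 0 ≤ C := by positivity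
  refine ⟨c, C + 1, (C + 1) / c, hc, by positivity, by positivity, fun α hα hα1 => ?_⟩
  have hsup := tikhonov_le_iSup hp hk₁ hlam hα hα1
  have htsum : ∑' j : ℕ, lam j ^ 2 / (lam j ^ 2 + α) ^ 2 ≤ (C + 1) * α ^ (-1 - 1 / (2 * p)) := by
    by_cases hs : Summable fun j : ℕ => lam j ^ 2 / (lam j ^ 2 + α) ^ 2
    · refine (tikhonov_tsum_le hp hk₁ hlam hα hα1 hs).trans ?_
      gcongr
      linarith
    · rw [tsum_eq_zero_of_not_summable hs]
      positivity
  refine ⟨hsup, htsum, htsum.trans ?_⟩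
  calc (C + 1) * α ^ (-1 - 1 / (2 * p)) = (C + 1) / c * α ^ (-(1 : ℝ) / (2 * p)) * (c / α) := by
        rw [show -1 - 1 / (2 * p) = -1 / (2 * p) - 1 by ring, Real.rpow_sub_one hα.ne']
        field_simp
    _ ≤ _ := by gcongr
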